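/- Let T be a finite tree all of whose vertices have degree 1 or 3. Construct a 2-complex K by taking, for each edge e_i of T, a rectangle R_i = e_i × [0,1], and whenever an edge e_i meets edges e_j, e_k at a degree-3 vertex below it, identifying the lower edge of R_i with the union of the upper edges of R_j and R_k via affine maps onto [0,1/2] and [1/2,1] respectively. Then K is homeomorphic to a closed 2-disc. -/

import Mathlib

open Set

/-- The disjoint union of rectangles `R_e = e × [0,1] × [0,1]`, one per edge `e`. -/
abbrev TreeRects (E : Type) [TopologicalSpace E] : Type :=
  E × (Set.Icc (0:ℝ) 1) × (Set.Icc (0:ℝ) 1)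

/-- The gluing relation: the lower edge (`second coordinate 0`) of the rectangle of `e` is
identified with the upper edges (`second coordinate 1`) of the rectangles of its two lower
edges `j, k`, via the affine maps `x ↦ 2x` on `[0,1/2]` and `x ↦ 2x - 1` on `[1/2,1]`. -/
def treeGlue (E : Type) [TopologicalSpace E] (lower : E → Option (E × E)) :
    TreeRects E → TreeRects E → Prop := fun p q =>
  ∃ e j k, lower e = some (j, k) ∧
    ((p.1 = e ∧ q.1 = j ∧ (p.2.1 : ℝ) ≤ 1/2 ∧ (p.2.2 : ℝ) = 0 ∧
        (q.2.1 : ℝ) = 2 * (p.2.1 : ℝ) ∧ (q.2.2 : ℝ) = 1) ∨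
     (p.1 = e ∧ q.1 = k ∧ 1/2 ≤ (p.2.1 : ℝ) ∧ (p.2.2 : ℝ) = 0 ∧
        (q.2.1 : ℝ) = 2 * (p.2.1 : ℝ) - 1 ∧ (q.2.2 : ℝ) = 1))

def sq17 : Set (ℝ × ℝ) := Icc 0 1 ×ˢ Icc 0 1

theorem mem_sq17 {z : ℝ × ℝ} : z ∈ sq17 ↔ (0 ≤ z.1 ∧ z.1 ≤ 1) ∧ (0 ≤ z.2 ∧ z.2 ≤ 1) := by
  exact Iff.rfl

noncomputable def phi0 (s t : ℝ) : ℝ × ℝ := (s, (1 - t) * (1/2 + min s (1 - s)))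
noncomputable def phi1 (z : ℝ × ℝ) : ℝ × ℝ :=
  ((z.1 - z.1 * z.2 / 2) / 2, (1 + z.1 + z.2 - z.1 * z.2) / 2)
noncomputable def mir17 (z : ℝ × ℝ) : ℝ × ℝ := (1 - z.1, z.2)
noncomputable def phi2 (z : ℝ × ℝ) : ℝ × ℝ := mir17 (phi1 (mir17 z))

theorem mir17_mem {z : ℝ × ℝ} (hz : z ∈ sq17) : mir17 z ∈ sq17 := by
  rw [mem_sq17] at *
  simp only [mir17]
  obtain ⟨⟨a, b⟩, c, d⟩ := hz
  exact ⟨⟨by linarith, by linarith⟩, c, d⟩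

theorem mir17_mir17 (z : ℝ × ℝ) : mir17 (mir17 z) = z := by simp [mir17]

theorem min17 {s : ℝ} (h0 : 0 ≤ s) (h1 : s ≤ 1) : 0 ≤ min s (1 - s) ∧ min s (1 - s) ≤ 1/2 := by
  rcases le_total s (1 - s) with h | h
  · rw [min_eq_left h]; constructor <;> linarith
  · rw [min_eq_right h]; constructor <;> linarith

theorem phi0_mem {s t : ℝ} (hs : s ∈ Icc (0:ℝ) 1) (ht : t ∈ Icc (0:ℝ) 1) : phi0 s t ∈ sq17 := by
  rw [mem_sq17]
  obtain ⟨a, b⟩ := hs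
  obtain ⟨c, d⟩ := ht
  obtain ⟨e, f⟩ := min17 a b
  simp only [phi0]
  exact ⟨⟨a, b⟩, by nlinarith, by nlinarith⟩

theorem phi0_mir (s t : ℝ) : phi0 (1 - s) t = mir17 (phi0 s t) := by
  simp [phi0, mir17, min_comm]

theorem phi1_mem {z : ℝ × ℝ} (hz : z ∈ sq17) : phi1 z ∈ sq17 := by
  rw [mem_sq17] at *
  obtain ⟨⟨a, b⟩, c, d⟩ := hz
  simp only [phi1]
  refine ⟨⟨?_, ?_⟩, ?_, ?_⟩ <;> nlinarith [mul_nonneg a c, mul_nonneg a (sub_nonneg.2 d),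
    mul_nonneg (sub_nonneg.2 b) (sub_nonneg.2 d)]

theorem phi2_mem {z : ℝ × ℝ} (hz : z ∈ sq17) : phi2 z ∈ sq17 :=
  mir17_mem (phi1_mem (mir17_mem hz))

theorem phi0_inj {s t s' t' : ℝ} (hs : s ∈ Icc (0:ℝ) 1)
    (h : phi0 s t = phi0 s' t') : s = s' ∧ t = t' := by
  simp only [phi0, Prod.mk.injEq] at h
  obtain ⟨rfl, h⟩ := h
  have := (min17 hs.1 hs.2).1
  have := mul_right_cancel₀ (by linarith) h
  exact ⟨rfl, by linarith⟩

theorem phi1_inj {y z : ℝ × ℝ} (hy : y ∈ sq17) (hz : z ∈ sq17) (h : phi1 y = phi1 z) : y = z := by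
  rw [mem_sq17] at *
  obtain ⟨x, v⟩ := y
  obtain ⟨x', v'⟩ := z
  simp only [phi1, Prod.mk.injEq] at *
  obtain ⟨⟨a, b⟩, c, d⟩ := hy
  obtain ⟨⟨a', b'⟩, c', d'⟩ := hz
  obtain ⟨h1, h2⟩ := h
  have e1 : x - v = x' - v' := by linarith
  have e2 : (1 - x) * (1 - v) = (1 - x') * (1 - v') := by linarith
  have : x = x' := by
    rcases lt_trichotomy x x' with h | h | h
    · nlinarith
    · exact h
    · nlinarith
  exact ⟨this, by linarith⟩

theorem phi2_inj {y z : ℝ × ℝ} (hy : y ∈ sq17) (hz : z ∈ sq17) (h : phi2 y = phi2 z) : y = z := by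
  have h := congrArg mir17 h
  simp only [phi2, mir17_mir17] at h
  have := phi1_inj (mir17_mem hy) (mir17_mem hz) h
  simpa [mir17_mir17] using congrArg mir17 this

theorem phi1_fst_le {y : ℝ × ℝ} (hy : y ∈ sq17) : (phi1 y).1 ≤ 1/2 := by
  rw [mem_sq17] at hy
  obtain ⟨⟨a, b⟩, c, d⟩ := hy
  simp only [phi1]
  nlinarith [mul_nonneg a c]

theorem phi01 {s t : ℝ} {y : ℝ × ℝ} (hs : s ∈ Icc (0:ℝ) 1) (ht : t ∈ Icc (0:ℝ) 1)
    (hy : y ∈ sq17) (h : phi0 s t = phi1 y) : t = 0 ∧ s ≤ 1/2 ∧ y = (2 * s, 0) := by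
  have hle := phi1_fst_le hy
  rw [← h] at hle
  rw [mem_sq17] at hy
  obtain ⟨⟨a, b⟩, c, d⟩ := hy
  obtain ⟨x, v⟩ := y
  obtain ⟨hs0, hs1⟩ := hs
  obtain ⟨ht0, ht1⟩ := ht
  simp only [phi0, phi1, Prod.mk.injEq] at *
  rw [min_eq_left (by linarith)] at h
  obtain ⟨h1, h2⟩ := h
  have key : v * (1 - x / 2) + t * (1 + 2 * s) = 0 := by subst h1; linarith
  have k1 : 0 ≤ v * (1 - x / 2) := mul_nonneg c (by linarith)
  have k2 : 0 ≤ t * (1 + 2 * s) := mul_nonneg ht0 (by linarith)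
  have k3 : t * (1 + 2 * s) = 0 := by linarith
  have k4 : v * (1 - x / 2) = 0 := by linarith
  have k5 : t = 0 := by
    rcases mul_eq_zero.1 k3 with h | h
    · exact h
    · linarith
  have k6 : v = 0 := by
    rcases mul_eq_zero.1 k4 with h | h
    · exact h
    · linarith
  subst k6
  exact ⟨k5, hle, by linarith, rfl⟩

theorem phi02 {s t : ℝ} {y : ℝ × ℝ} (hs : s ∈ Icc (0:ℝ) 1) (ht : t ∈ Icc (0:ℝ) 1)
    (hy : y ∈ sq17) (h : phi0 s t = phi2 y) : t = 0 ∧ 1/2 ≤ s ∧ y = (2 * s - 1, 0) := by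
  have h' : phi0 (1 - s) t = phi1 (mir17 y) := by
    rw [phi0_mir, h, phi2, mir17_mir17]
  obtain ⟨h1, h2, h3⟩ := phi01 ⟨by linarith [hs.2], by linarith [hs.1]⟩ ht (mir17_mem hy) h'
  refine ⟨h1, by linarith, ?_⟩
  rw [← mir17_mir17 y, h3]
  simp only [mir17, Prod.mk.injEq, and_true]
  ring

theorem phi1_half {y : ℝ × ℝ} (hy : y ∈ sq17) (h : (phi1 y).1 = 1/2) : y = (1, 0) := by
  rw [mem_sq17] at hy
  obtain ⟨⟨a, b⟩, c, d⟩ := hy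
  obtain ⟨x, v⟩ := y
  simp only [phi1] at *
  have := mul_nonneg a c
  have hx : x = 1 := by linarith
  subst hx
  simp only [Prod.mk.injEq, true_and]
  linarith

theorem phi12 {y z : ℝ × ℝ} (hy : y ∈ sq17) (hz : z ∈ sq17) (h : phi1 y = phi2 z) :
    y = (1, 0) ∧ z = (0, 0) := by
  have h1 := phi1_fst_le hy
  have h2 := phi1_fst_le (mir17_mem hz)
  have h3 := congrArg Prod.fst h
  have h4 : (phi2 z).1 = 1 - (phi1 (mir17 z)).1 := rfl
  refine ⟨phi1_half hy (by linarith), ?_⟩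
  rw [← mir17_mir17 z, phi1_half (mir17_mem hz) (by linarith)]
  simp [mir17]

theorem phi_surj_left {z : ℝ × ℝ} (hz : z ∈ sq17) (hle : z.1 ≤ 1/2) :
    (∃ s ∈ Icc (0:ℝ) 1, ∃ t ∈ Icc (0:ℝ) 1, phi0 s t = z) ∨ ∃ y ∈ sq17, phi1 y = z := by
  rw [mem_sq17] at hz
  obtain ⟨⟨a, b⟩, c, d⟩ := hz
  obtain ⟨X, W⟩ := z
  simp only at *
  rcases le_total W (1/2 + X) with h | h
  · left
    have hpos : 0 < 1/2 + X := by linarith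
    refine ⟨X, ⟨a, b⟩, 1 - W / (1/2 + X), ⟨?_, ?_⟩, ?_⟩
    · rw [sub_nonneg, div_le_one hpos]; exact h
    · linarith [div_nonneg c hpos.le]
    · simp only [phi0, Prod.mk.injEq, true_and]
      rw [min_eq_left (by linarith)]
      field_simp
      ring
  · right
    obtain ⟨P, hP⟩ : ∃ P, P = 2 * X := ⟨_, rfl⟩
    obtain ⟨Q, hQ⟩ : ∃ Q, Q = 2 * W - 1 - P := ⟨_, rfl⟩
    have hP0 : 0 ≤ P := by linarith
    have hQ0 : 0 ≤ Q := by linarith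
    have hPQ : P + Q ≤ 1 := by linarith
    obtain ⟨r, hr⟩ : ∃ r, r = Real.sqrt ((Q - P)^2 + 4 * (1 - P - Q)) := ⟨_, rfl⟩
    have hr0 : 0 ≤ r := hr ▸ Real.sqrt_nonneg _
    have hr2 : r ^ 2 = (Q - P)^2 + 4 * (1 - P - Q) := by
      rw [hr, Real.sq_sqrt]; nlinarith [sq_nonneg (Q - P)]
    have u1 : |Q - P| ≤ r := abs_le_of_sq_le_sq (by nlinarith) hr0
    have u2 := abs_le.1 u1
    have u3 : r ≤ 2 - (Q - P) := abs_le_of_sq_le_sq' (by nlinarith) (by linarith) |>.2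
    have u4 : r ≤ 2 + (Q - P) := abs_le_of_sq_le_sq' (by nlinarith) (by linarith) |>.2
    refine ⟨(1 - (Q - P + r)/2, 1 - (r - (Q - P))/2), ?_, ?_⟩
    · rw [mem_sq17]
      simp only
      refine ⟨⟨?_, ?_⟩, ?_, ?_⟩ <;> linarith
    · simp only [phi1, Prod.mk.injEq]
      constructor <;> nlinarith

theorem phi_surj {z : ℝ × ℝ} (hz : z ∈ sq17) :
    (∃ s ∈ Icc (0:ℝ) 1, ∃ t ∈ Icc (0:ℝ) 1, phi0 s t = z) ∨ (∃ y ∈ sq17, phi1 y = z) ∨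
      ∃ y ∈ sq17, phi2 y = z := by
  rcases le_total z.1 (1/2) with h | h
  · rcases phi_surj_left hz h with h | h
    · exact Or.inl h
    · exact Or.inr (Or.inl h)
  · rcases phi_surj_left (mir17_mem hz) (by simp only [mir17]; linarith) with
      ⟨s, hs, t, ht, h⟩ | ⟨y, hy, h⟩
    · refine Or.inl ⟨1 - s, ⟨by linarith [hs.2], by linarith [hs.1]⟩, t, ht, ?_⟩
      rw [phi0_mir, h, mir17_mir17]
    · refine Or.inr (Or.inr ⟨mir17 y, mir17_mem hy, ?_⟩)
      rw [phi2, mir17_mir17, h, mir17_mir17]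

theorem sq17_disc : Nonempty (sq17 ≃ₜ (Metric.closedBall (0 : EuclideanSpace ℝ (Fin 2)) 1)) := by
  let L : (ℝ × ℝ) ≃L[ℝ] EuclideanSpace ℝ (Fin 2) :=
    (ContinuousLinearEquiv.finTwoArrow ℝ ℝ).symm.trans (EuclideanSpace.equiv (Fin 2) ℝ).symm
  have hcomp : IsCompact sq17 := isCompact_Icc.prod isCompact_Icc
  have hconv : Convex ℝ sq17 := (convex_Icc 0 1).prod (convex_Icc 0 1)
  have hc : Convex ℝ (L '' sq17) := hconv.linear_image L.toLinearEquiv.toLinearMap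
  have hne : (interior (L '' sq17)).Nonempty := by
    have : interior (L '' sq17) = L '' interior sq17 := (L.toHomeomorph.image_interior sq17).symm
    rw [this]
    refine Set.Nonempty.image _ ⟨(1/2, 1/2), ?_⟩
    rw [sq17, interior_prod_eq, interior_Icc]
    constructor <;> constructor <;> norm_num
  have hk : IsCompact (L '' sq17) := hcomp.image L.continuous
  obtain ⟨h, -, h2, -⟩ := exists_homeomorph_image_interior_closure_frontier_eq_unitBall hc hne
    hk.isBounded
  rw [hk.isClosed.closure_eq] at h2
  exact ⟨(L.toHomeomorph.image sq17).trans ((h.image _).trans (Homeomorph.setCongr h2))⟩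

theorem continuous_phi0 : Continuous (fun z : Icc (0:ℝ) 1 × Icc (0:ℝ) 1 =>
    phi0 (z.1 : ℝ) (z.2 : ℝ)) := by
  unfold phi0; fun_prop

theorem continuous_phi1 : Continuous phi1 := by
  unfold phi1; fun_prop

theorem continuous_phi2 : Continuous phi2 := by
  unfold phi2 mir17
  have := continuous_phi1
  fun_prop

theorem phi1_top {s : ℝ} (h : s ≤ 1/2) : phi1 (2 * s, 0) = phi0 s 0 := by
  simp only [phi0, phi1, Prod.mk.injEq]
  rw [min_eq_left (by linarith)]
  constructor <;> ring

theorem phi2_top {s : ℝ} (h : 1/2 ≤ s) : phi2 (2 * s - 1, 0) = phi0 s 0 := by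
  simp only [phi0, phi1, phi2, mir17, Prod.mk.injEq]
  rw [min_eq_right (by linarith)]
  constructor <;> ring

/-- `F` identifies the part of the complex at or below `e` with the square. -/
structure GoodMap (E : Type) [TopologicalSpace E] (lower : E → Option (E × E))
    (S : Set E) (e : E) (F : TreeRects E → ℝ × ℝ) : Prop where
  cont : Continuous F
  mem : ∀ p, F p ∈ sq17
  top : ∀ p : TreeRects E, p.1 = e → (p.2.2 : ℝ) = 1 → F p = ((p.2.1 : ℝ), 0)
  glue : ∀ p q, p.1 ∈ S → treeGlue E lower p q → F p = F q
  exact : ∀ p q, p.1 ∈ S → q.1 ∈ S → F p = F q →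
    Quot.mk (treeGlue E lower) p = Quot.mk (treeGlue E lower) q
  surj : ∀ z ∈ sq17, ∃ p, p.1 ∈ S ∧ F p = z

theorem goodMap_leaf (E : Type) [TopologicalSpace E] (lower : E → Option (E × E)) (e : E)
    (he : lower e = none) :
    GoodMap E lower {e} e (fun p => ((p.2.1 : ℝ), 1 - (p.2.2 : ℝ))) where
  cont := by fun_prop
  mem p := by
    rw [mem_sq17]
    have h1 := p.2.1.2
    have h2 := p.2.2.2
    exact ⟨h1, by linarith [h2.2], by linarith [h2.1]⟩
  top p h1 h2 := by simp [h2]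
  glue := by
    rintro p q hp ⟨e', j, k, h, h'⟩
    rw [mem_singleton_iff] at hp
    have : p.1 = e' := by tauto
    rw [← this, hp, he] at h
    cases h
  exact := by
    rintro ⟨e1, x, y⟩ ⟨e2, x', y'⟩ h1 h2 h
    simp only [mem_singleton_iff] at h1 h2
    simp only [Prod.mk.injEq] at h
    have hx : x = x' := Subtype.ext h.1
    have hy : y = y' := Subtype.ext (by linarith [h.2])
    rw [h1, h2, hx, hy]
  surj := by
    intro z hz
    rw [mem_sq17] at hz
    refine ⟨(e, ⟨z.1, hz.1⟩, ⟨1 - z.2, by linarith [hz.2.2], by linarith [hz.2.1]⟩), rfl, ?_⟩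
    simp

theorem goodMap_node (E : Type) [TopologicalSpace E] [DiscreteTopology E]
    (lower : E → Option (E × E)) (e j k : E) (he : lower e = some (j, k))
    (S Sj Sk : Set E) (hS : ∀ d, d ∈ S ↔ d = e ∨ d ∈ Sj ∨ d ∈ Sk)
    (hej : e ∉ Sj) (hek : e ∉ Sk) (hjk : ∀ d, d ∈ Sj → d ∉ Sk)
    (hj : j ∈ Sj) (hk : k ∈ Sk)
    (hclj : ∀ d a b, lower d = some (a, b) → d ∈ Sj → a ∈ Sj ∧ b ∈ Sj)
    (hclk : ∀ d a b, lower d = some (a, b) → d ∈ Sk → a ∈ Sk ∧ b ∈ Sk)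
    (Fj Fk : TreeRects E → ℝ × ℝ) (Hj : GoodMap E lower Sj j Fj) (Hk : GoodMap E lower Sk k Fk) :
    ∃ F, GoodMap E lower S e F := by
  classical
  let F : TreeRects E → ℝ × ℝ := fun p =>
    if p.1 = e then phi0 p.2.1 p.2.2 else if p.1 ∈ Sj then phi1 (Fj p) else phi2 (Fk p)
  have Fe : ∀ p : TreeRects E, p.1 = e → F p = phi0 p.2.1 p.2.2 := fun p h => if_pos h
  have FJ : ∀ p : TreeRects E, p.1 ∈ Sj → F p = phi1 (Fj p) := by
    intro p h
    have : p.1 ≠ e := fun h' => hej (h' ▸ h)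
    simp only [F, if_neg this, if_pos h]
  have FK : ∀ p : TreeRects E, p.1 ∈ Sk → F p = phi2 (Fk p) := by
    intro p h
    have h1 : p.1 ≠ e := fun h' => hek (h' ▸ h)
    have h2 : p.1 ∉ Sj := fun h' => hjk _ h' h
    simp only [F, if_neg h1, if_neg h2]
  -- the two comparison facts
  have Q0J : ∀ p q : TreeRects E, p.1 = e → q.1 ∈ Sj → F p = F q →
      Quot.mk (treeGlue E lower) p = Quot.mk (treeGlue E lower) q := by
    intro p q hp hq h
    rw [Fe p hp, FJ q hq] at h
    obtain ⟨h1, h2, h3⟩ := phi01 p.2.1.2 p.2.2.2 (Hj.mem q) h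
    have h0 := p.2.1.2.1
    let r : TreeRects E := (j, ⟨2 * (p.2.1 : ℝ), by linarith, by linarith⟩, ⟨1, by simp⟩)
    have e1 : Quot.mk (treeGlue E lower) p = Quot.mk (treeGlue E lower) r :=
      Quot.sound ⟨e, j, k, he, Or.inl ⟨hp, rfl, h2, h1, rfl, rfl⟩⟩
    rw [e1]
    refine Hj.exact r q hj hq ?_
    rw [Hj.top r rfl rfl, h3]
  have Q0K : ∀ p q : TreeRects E, p.1 = e → q.1 ∈ Sk → F p = F q →
      Quot.mk (treeGlue E lower) p = Quot.mk (treeGlue E lower) q := by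
    intro p q hp hq h
    rw [Fe p hp, FK q hq] at h
    obtain ⟨h1, h2, h3⟩ := phi02 p.2.1.2 p.2.2.2 (Hk.mem q) h
    have h0 := p.2.1.2.2
    let r : TreeRects E := (k, ⟨2 * (p.2.1 : ℝ) - 1, by linarith, by linarith⟩, ⟨1, by simp⟩)
    have e1 : Quot.mk (treeGlue E lower) p = Quot.mk (treeGlue E lower) r :=
      Quot.sound ⟨e, j, k, he, Or.inr ⟨hp, rfl, h2, h1, rfl, rfl⟩⟩
    rw [e1]
    refine Hk.exact r q hk hq ?_
    rw [Hk.top r rfl rfl, h3]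
  have QJK : ∀ p q : TreeRects E, p.1 ∈ Sj → q.1 ∈ Sk → F p = F q →
      Quot.mk (treeGlue E lower) p = Quot.mk (treeGlue E lower) q := by
    intro p q hp hq h
    have h' := h
    rw [FJ p hp, FK q hq] at h'
    obtain ⟨h1, h2⟩ := phi12 (Hj.mem p) (Hk.mem q) h'
    let r : TreeRects E := (e, ⟨1/2, by norm_num, by norm_num⟩, ⟨0, by simp⟩)
    have hr : F r = F p := by
      rw [Fe r rfl, FJ p hp, h1]
      have := phi1_top (le_refl (1/2 : ℝ))
      norm_num at this
      simpa [r] using this.symm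
    rw [← Q0J r p rfl hp hr]
    exact Q0K r q rfl hq (hr.trans h)
  refine ⟨F, ?_, ?_, ?_, ?_, ?_, ?_⟩
  · rw [continuous_prod_of_discrete_left]
    intro a
    by_cases h1 : a = e
    · simp only [F, if_pos h1]
      exact continuous_phi0
    · by_cases h2 : a ∈ Sj
      · simp only [F, if_neg h1, if_pos h2]
        exact continuous_phi1.comp (Hj.cont.comp (by fun_prop))
      · simp only [F, if_neg h1, if_neg h2]
        exact continuous_phi2.comp (Hk.cont.comp (by fun_prop))
  · intro p
    simp only [F]
    split_ifs
    · exact phi0_mem p.2.1.2 p.2.2.2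
    · exact phi1_mem (Hj.mem p)
    · exact phi2_mem (Hk.mem p)
  · intro p h1 h2
    rw [Fe p h1, h2]
    simp [phi0]
  · intro p q hp hg
    obtain ⟨e', a, b, hl, hg'⟩ := id hg
    have hpe : p.1 = e' := by tauto
    rcases (hS _).1 hp with h | h | h
    · rw [← hpe, h, he] at hl
      simp only [Option.some.injEq, Prod.mk.injEq] at hl
      obtain ⟨rfl, rfl⟩ := hl
      rcases hg' with ⟨-, hq, h1, h2, h3, h4⟩ | ⟨-, hq, h1, h2, h3, h4⟩
      · rw [Fe p h, FJ q (hq ▸ hj), Hj.top q hq h4, h3, h2, phi1_top h1]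
      · rw [Fe p h, FK q (hq ▸ hk), Hk.top q hq h4, h3, h2, phi2_top h1]
    · have hcl := hclj e' a b hl (hpe ▸ h)
      have hq : q.1 ∈ Sj := by
        rcases hg' with hg' | hg'
        · rw [hg'.2.1]; exact hcl.1
        · rw [hg'.2.1]; exact hcl.2
      rw [FJ p h, FJ q hq, Hj.glue p q h hg]
    · have hcl := hclk e' a b hl (hpe ▸ h)
      have hq : q.1 ∈ Sk := by
        rcases hg' with hg' | hg'
        · rw [hg'.2.1]; exact hcl.1
        · rw [hg'.2.1]; exact hcl.2
      rw [FK p h, FK q hq, Hk.glue p q h hg]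
  · intro p q hp hq h
    rcases (hS _).1 hp with h1 | h1 | h1 <;> rcases (hS _).1 hq with h2 | h2 | h2
    · rw [Fe p h1, Fe q h2] at h
      obtain ⟨h3, h4⟩ := phi0_inj p.2.1.2 h
      have : p = q := Prod.ext (h1.trans h2.symm) (Prod.ext (Subtype.ext h3) (Subtype.ext h4))
      rw [this]
    · exact Q0J p q h1 h2 h
    · exact Q0K p q h1 h2 h
    · exact (Q0J q p h2 h1 h.symm).symm
    · rw [FJ p h1, FJ q h2] at h
      exact Hj.exact p q h1 h2 (phi1_inj (Hj.mem p) (Hj.mem q) h)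
    · exact QJK p q h1 h2 h
    · exact (Q0K q p h2 h1 h.symm).symm
    · exact (QJK q p h2 h1 h.symm).symm
    · rw [FK p h1, FK q h2] at h
      exact Hk.exact p q h1 h2 (phi2_inj (Hk.mem p) (Hk.mem q) h)
  · intro z hz
    rcases phi_surj hz with ⟨s, hs, t, ht, h⟩ | ⟨y, hy, h⟩ | ⟨y, hy, h⟩
    · exact ⟨(e, ⟨s, hs⟩, ⟨t, ht⟩), (hS _).2 (Or.inl rfl), by rw [Fe _ rfl]; exact h⟩
    · obtain ⟨p, hp, hpy⟩ := Hj.surj y hy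
      exact ⟨p, (hS _).2 (Or.inr (Or.inl hp)), by rw [FJ p hp, hpy, h]⟩
    · obtain ⟨p, hp, hpy⟩ := Hk.surj y hy
      exact ⟨p, (hS _).2 (Or.inr (Or.inr hp)), by rw [FK p hp, hpy, h]⟩

/-- let `T` be a finite plane tree with all vertices of degree 1 or 3,
encoded by its set of edges `E` with, for each edge, the (ordered) pair of edges directly
below it (`lower`) and the edge directly above it (`parent`).  Gluing the rectangles
`R_e = e × [0,1] × [0,1]` along `treeGlue` yields a space homeomorphic to the closed
2-disc. -/
theorem stmt_17 (E : Type) [Fintype E] [Nonempty E] [DecidableEq E]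
    [TopologicalSpace E] [DiscreteTopology E]
    (lower : E → Option (E × E)) (parent : E → Option E)
    (hcoh : ∀ e j k, lower e = some (j, k) →
      j ≠ k ∧ parent j = some e ∧ parent k = some e)
    (hcoh' : ∀ j e, parent j = some e →
      ∃ k, lower e = some (j, k) ∨ lower e = some (k, j))
    (root : E) (hroot : parent root = none)
    (htree : ∀ e, Relation.ReflTransGen (fun a b => parent a = some b) e root) :
    Nonempty (Quot (treeGlue E lower) ≃ₜ
      (Metric.closedBall (0 : EuclideanSpace ℝ (Fin 2)) 1)) := by
  let r : E → E → Prop := fun a b => parent a = some b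
  have hru : Relator.RightUnique r := by
    intro a b c hb hc
    exact Option.some.inj (hb.symm.trans hc)
  -- acyclicity
  have hirr : ∀ e, ¬ Relation.TransGen r e e := by
    intro e
    induction htree e using Relation.ReflTransGen.head_induction_on with
    | refl =>
      intro h
      obtain ⟨c, hc, -⟩ := Relation.TransGen.head'_iff.1 h
      have hc' : parent root = some c := hc
      rw [hroot] at hc'
      cases hc'
    | head hab _ ih =>
      intro h
      obtain ⟨c, hc, hc2⟩ := Relation.TransGen.head'_iff.1 h
      have := hru hc hab
      subst this
      exact ih (Relation.TransGen.tail' hc2 hc)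
  have hwf : WellFounded (Relation.TransGen r) := by
    haveI : Std.Irrefl (Relation.TransGen r) := ⟨hirr⟩
    exact Finite.wellFounded_of_trans_of_irrefl _
  let S : E → Set E := fun e => {d | Relation.ReflTransGen r d e}
  have hcl : ∀ c d a b, lower d = some (a, b) → d ∈ S c → a ∈ S c ∧ b ∈ S c := by
    intro c d a b h hd
    obtain ⟨-, h1, h2⟩ := hcoh _ _ _ h
    exact ⟨Relation.ReflTransGen.head h1 hd, Relation.ReflTransGen.head h2 hd⟩
  have main : ∀ e, ∃ F, GoodMap E lower (S e) e F := by
    intro e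
    induction e using hwf.induction with
    | _ e ih =>
    rcases hl : lower e with _ | ⟨j, k⟩
    · have : S e = {e} := by
        ext d
        simp only [S, mem_setOf_eq, mem_singleton_iff]
        constructor
        · intro h
          rcases Relation.ReflTransGen.cases_tail h with h | ⟨c, -, hc⟩
          · exact h.symm
          · obtain ⟨k, hk | hk⟩ := hcoh' c e hc <;> rw [hl] at hk <;> cases hk
        · rintro rfl
          exact Relation.ReflTransGen.refl
      rw [this]
      exact ⟨_, goodMap_leaf E lower e hl⟩
    · obtain ⟨hne, hpj, hpk⟩ := hcoh _ _ _ hl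
      have hpj : r j e := hpj
      have hpk : r k e := hpk
      obtain ⟨Fj, Hj⟩ := ih j (Relation.TransGen.single hpj)
      obtain ⟨Fk, Hk⟩ := ih k (Relation.TransGen.single hpk)
      have aux : ∀ a b, a ≠ b → r a e → r b e → ¬ Relation.ReflTransGen r a b := by
        intro a b hab ha hb h
        rcases Relation.ReflTransGen.cases_head h with h | ⟨c, hc, hcb⟩
        · exact hab h
        · have := hru hc ha
          subst this
          exact hirr _ (Relation.TransGen.tail' hcb hb)
      refine goodMap_node E lower e j k hl (S e) (S j) (S k) ?_ ?_ ?_ ?_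
        Relation.ReflTransGen.refl Relation.ReflTransGen.refl (hcl j) (hcl k) Fj Fk Hj Hk
      · intro d
        constructor
        · intro h
          rcases Relation.ReflTransGen.cases_tail h with h | ⟨c, hdc, hc⟩
          · exact Or.inl h.symm
          · right
            obtain ⟨k', hk | hk⟩ := hcoh' c e hc <;> rw [hl] at hk <;>
              simp only [Option.some.injEq, Prod.mk.injEq] at hk
            · left; rw [hk.1]; exact hdc
            · right; rw [hk.2]; exact hdc
        · rintro (rfl | h | h)
          · exact Relation.ReflTransGen.refl
          · exact Relation.ReflTransGen.tail h hpj
          · exact Relation.ReflTransGen.tail h hpk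
      · intro h
        exact hirr e (Relation.TransGen.tail' h hpj)
      · intro h
        exact hirr e (Relation.TransGen.tail' h hpk)
      · intro d h1 h2
        rcases Relation.ReflTransGen.total_of_right_unique hru h1 h2 with h | h
        · exact aux j k hne hpj hpk h
        · exact aux k j hne.symm hpk hpj h
  obtain ⟨F, HF⟩ := main root
  let G : Quot (treeGlue E lower) → sq17 :=
    Quot.lift (fun p => ⟨F p, HF.mem p⟩) (fun p q h => Subtype.ext (HF.glue p q (htree _) h))
  have hG : Continuous G :=
    continuous_quot_lift _ (HF.cont.subtype_mk _)
  have hbij : Function.Bijective G := by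
    constructor
    · rintro ⟨p⟩ ⟨q⟩ h
      exact HF.exact p q (htree _) (htree _) (congrArg Subtype.val h)
    · rintro ⟨z, hz⟩
      obtain ⟨p, -, hp⟩ := HF.surj z hz
      exact ⟨Quot.mk _ p, Subtype.ext hp⟩
  obtain ⟨h⟩ := sq17_disc
  have hG' : Continuous (Equiv.ofBijective G hbij) := hG
  exact ⟨hG'.homeoOfEquivCompactToT2.trans h⟩
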